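/- Let p be a real number with p > 2 and let n be a positive integer. Let A be the n×n real matrix with entries a_{ij} = 2p^{i+j} if j > i, a_{ij} = p^{2i} if j = i, and a_{ij} = 0 if j < i. Then the set of Nash equilibria of the bimatrix game (A, Aᵀ) is finite and has exactly 2ⁿ − 1 elements. -/

import Mathlib

open Matrix BigOperators

/-- The `n × n` payoff matrix of the paper, with `1`-based indices `i+1, j+1`
for `i j : Fin n`: entry `2 p^{i+j}` above the diagonal, `p^{2i}` on the
diagonal, `0` below it. -/
noncomputable def gameA (p : ℝ) (n : ℕ) : Matrix (Fin n) (Fin n) ℝ :=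
  fun i j =>
    if (i : ℕ) < (j : ℕ) then 2 * p ^ (((i : ℕ) + 1) + ((j : ℕ) + 1))
    else if (i : ℕ) = (j : ℕ) then p ^ (2 * ((i : ℕ) + 1))
    else 0

/-- A mixed strategy: nonnegative components summing to `1`. -/
def IsMixed {I : Type*} [Fintype I] (y : I → ℝ) : Prop :=
  (∀ i, 0 ≤ y i) ∧ ∑ i, y i = 1

/-- `(x, y)` is a Nash equilibrium of the bimatrix game `(A, B)`. -/
def IsNash {I J : Type*} [Fintype I] [Fintype J]
    (A B : Matrix I J ℝ) (x : I → ℝ) (y : J → ℝ) : Prop :=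
  IsMixed x ∧ IsMixed y ∧
  (∀ x' : I → ℝ, IsMixed x' → x' ⬝ᵥ A.mulVec y ≤ x ⬝ᵥ A.mulVec y) ∧
  (∀ y' : J → ℝ, IsMixed y' → x ⬝ᵥ B.mulVec y' ≤ x ⬝ᵥ B.mulVec y)

/-- A mixed strategy is a best response to the payoff vector `v` iff it is supported on the
coordinates where `v` is maximal. -/
lemma IsMixed.forall_dotProduct_le_iff {I : Type*} [Fintype I] {x : I → ℝ} (hx : IsMixed x)
    (v : I → ℝ) :
    (∀ x' : I → ℝ, IsMixed x' → x' ⬝ᵥ v ≤ x ⬝ᵥ v) ↔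
      ∃ c : ℝ, ∀ i, v i ≤ c ∧ (x i ≠ 0 → v i = c) := by
  classical
  constructor
  · intro h
    have hle : ∀ i, v i ≤ x ⬝ᵥ v := fun i => by
      have hs : IsMixed (Pi.single i (1 : ℝ)) :=
        ⟨fun j => by by_cases hj : j = i <;> simp [hj], by simp⟩
      simpa using h _ hs
    refine ⟨x ⬝ᵥ v, fun i => ⟨hle i, fun hi => ?_⟩⟩
    have hsum : ∑ j, x j * (x ⬝ᵥ v - v j) = 0 := by
      simp only [mul_sub, Finset.sum_sub_distrib, ← Finset.sum_mul, hx.2, one_mul]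
      simp [dotProduct]
    have := (Finset.sum_eq_zero_iff_of_nonneg
      (fun j _ => mul_nonneg (hx.1 j) (sub_nonneg.2 (hle j)))).1 hsum i (Finset.mem_univ i)
    rcases mul_eq_zero.1 this with h0 | h0
    · exact absurd h0 hi
    · linarith
  · rintro ⟨c, hc⟩ x' hx'
    have h1 : x ⬝ᵥ v = c := by
      calc x ⬝ᵥ v = ∑ i, x i * c := Finset.sum_congr rfl fun i _ => by
            by_cases hi : x i = 0
            · simp [hi]
            · rw [(hc i).2 hi]
        _ = c := by rw [← Finset.sum_mul, hx.2, one_mul]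
    calc x' ⬝ᵥ v ≤ ∑ i, x' i * c :=
          Finset.sum_le_sum fun i _ => mul_le_mul_of_nonneg_left (hc i).1 (hx'.1 i)
      _ = x ⬝ᵥ v := by rw [← Finset.sum_mul, hx'.2, one_mul, h1]

lemma isNash_transpose_iff {I : Type*} [Fintype I] (A : Matrix I I ℝ) (x y : I → ℝ) :
    IsNash A Aᵀ x y ↔ IsMixed x ∧ IsMixed y ∧
      (∃ c : ℝ, ∀ i, (A *ᵥ y) i ≤ c ∧ (x i ≠ 0 → (A *ᵥ y) i = c)) ∧
      (∃ c : ℝ, ∀ i, (A *ᵥ x) i ≤ c ∧ (y i ≠ 0 → (A *ᵥ x) i = c)) := by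
  have key : ∀ y' : I → ℝ, x ⬝ᵥ Aᵀ *ᵥ y' = y' ⬝ᵥ A *ᵥ x := fun y' => by
    rw [dotProduct_mulVec, vecMul_transpose, dotProduct_comm]
  simp only [IsNash, key]
  refine and_congr_right fun hx => and_congr_right fun hy => ?_
  rw [hx.forall_dotProduct_le_iff, hy.forall_dotProduct_le_iff]

section gameA

variable {p : ℝ} {n : ℕ}

lemma gameA_of_lt {i j : Fin n} (h : i < j) :
    gameA p n i j = 2 * p ^ (i + 1 : ℕ) * p ^ (j + 1 : ℕ) := by
  rw [gameA, if_pos (Fin.lt_def.1 h), pow_add]; ring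

lemma gameA_self (i : Fin n) : gameA p n i i = p ^ (i + 1 : ℕ) * p ^ (i + 1 : ℕ) := by
  rw [gameA, if_neg (lt_irrefl _), if_pos rfl, two_mul, pow_add]

lemma gameA_of_gt {i j : Fin n} (h : j < i) : gameA p n i j = 0 := by
  have h' : (j : ℕ) < i := h
  rw [gameA, if_neg (by omega), if_neg (by omega)]

lemma gameA_mulVec_apply (y : Fin n → ℝ) (i : Fin n) :
    (gameA p n *ᵥ y) i = ∑ j, gameA p n i j * y j := rfl

lemma gameA_nonneg (hp : 0 ≤ p) (i j : Fin n) : 0 ≤ gameA p n i j := by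
  unfold gameA
  split_ifs <;> positivity

lemma two_mul_pow_lt_pow (hp : 2 < p) {i j : ℕ} (h : i < j) : 2 * p ^ i < p ^ j := by
  calc 2 * p ^ i < p * p ^ i := by gcongr
    _ = p ^ (i + 1) := by ring
    _ ≤ p ^ j := pow_le_pow_right₀ (by linarith) h

lemma gameA_mulVec_nonneg (hp : 0 ≤ p) {y : Fin n → ℝ} (hy : ∀ i, 0 ≤ y i) (i : Fin n) :
    0 ≤ (gameA p n *ᵥ y) i := by
  rw [gameA_mulVec_apply]
  exact Finset.sum_nonneg fun j _ => mul_nonneg (gameA_nonneg hp i j) (hy j)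

lemma gameA_mulVec_pos (hp : 0 < p) {y : Fin n → ℝ} (hy : ∀ i, 0 ≤ y i) {i : Fin n}
    (hi : 0 < y i) : 0 < (gameA p n *ᵥ y) i := by
  rw [gameA_mulVec_apply]
  refine Finset.sum_pos' (fun j _ => mul_nonneg (gameA_nonneg hp.le i j) (hy j))
    ⟨i, Finset.mem_univ i, mul_pos ?_ hi⟩
  rw [gameA_self]
  positivity

lemma IsMixed.exists_pos {I : Type*} [Fintype I] {y : I → ℝ} (hy : IsMixed y) :
    ∃ i, 0 < y i := by
  by_contra! h
  have := Finset.sum_nonpos fun i (_ : i ∈ Finset.univ) => h i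
  linarith [hy.2]

/-- The best responses to a mixed strategy `y` have support contained in that of `y`. -/
lemma ne_zero_of_gameA_mulVec_eq_max (hp : 2 < p) {y : Fin n → ℝ} (hy : IsMixed y) {c : ℝ}
    (hc : ∀ i, (gameA p n *ᵥ y) i ≤ c) {i : Fin n} (hi : (gameA p n *ᵥ y) i = c) :
    y i ≠ 0 := by
  intro hyi
  have hp0 : 0 < p := by linarith
  have hcpos : 0 < c := by
    obtain ⟨k, hk⟩ := hy.exists_pos
    exact (gameA_mulVec_pos hp0 hy.1 hk).trans_le (hc k)
  have hex : (Finset.univ.filter fun j => i < j ∧ y j ≠ 0).Nonempty := by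
    by_contra hne
    rw [Finset.not_nonempty_iff_eq_empty, Finset.filter_eq_empty_iff] at hne
    have h0 : (gameA p n *ᵥ y) i = 0 := by
      rw [gameA_mulVec_apply]
      refine Finset.sum_eq_zero fun j _ => ?_
      rcases lt_trichotomy i j with h | h | h
      · have : y j = 0 := by
          by_contra hj
          exact hne (Finset.mem_univ j) ⟨h, hj⟩
        simp [this]
      · simp [← h, hyi]
      · simp [gameA_of_gt h]
    linarith
  obtain ⟨j, hj, hmin⟩ := Finset.exists_min_image _ id hex
  simp only [Finset.mem_filter, Finset.mem_univ, true_and, id] at hj hmin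
  have hlt : (gameA p n *ᵥ y) i < (gameA p n *ᵥ y) j := by
    have hpow : 2 * p ^ (i + 1 : ℕ) < p ^ (j + 1 : ℕ) :=
      two_mul_pow_lt_pow hp (Nat.succ_lt_succ hj.1)
    rw [gameA_mulVec_apply, gameA_mulVec_apply]
    refine Finset.sum_lt_sum (fun k _ => ?_) ⟨j, Finset.mem_univ j, ?_⟩
    · rcases lt_trichotomy k j with h | h | h
      · have : gameA p n i k * y k = 0 := by
          rcases lt_trichotomy i k with h' | h' | h'
          · have : y k = 0 := by
              by_contra hk
              exact absurd (hmin k ⟨h', hk⟩) (not_le.2 h)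
            simp [this]
          · simp [← h', hyi]
          · simp [gameA_of_gt h']
        rw [this]
        exact mul_nonneg (gameA_nonneg hp0.le _ _) (hy.1 k)
      · subst h
        refine mul_le_mul_of_nonneg_right ?_ (hy.1 k)
        rw [gameA_of_lt hj.1, gameA_self]
        gcongr
      · refine mul_le_mul_of_nonneg_right ?_ (hy.1 k)
        rw [gameA_of_lt h, gameA_of_lt (hj.1.trans h)]
        have : p ^ (i + 1 : ℕ) ≤ p ^ (j + 1 : ℕ) := by
          linarith [pow_pos hp0 (i + 1 : ℕ)]
        gcongr
    · refine mul_lt_mul_of_pos_right ?_ (lt_of_le_of_ne (hy.1 j) hj.2.symm)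
      rw [gameA_of_lt hj.1, gameA_self]
      gcongr
  linarith [hc j]

/-- The principal submatrices of `gameA` have trivial kernel. -/
lemma eq_zero_of_gameA_mulVec_eq_zero (hp : 0 < p) {d : Fin n → ℝ}
    (hd : ∀ i, d i ≠ 0 → (gameA p n *ᵥ d) i = 0) : d = 0 := by
  by_contra hne
  obtain ⟨k, hk⟩ := Function.ne_iff.1 hne
  obtain ⟨i, hi, hmax⟩ := Finset.exists_max_image (Finset.univ.filter fun j => d j ≠ 0) id
    ⟨k, by simpa using hk⟩
  simp only [Finset.mem_filter, Finset.mem_univ, true_and, id] at hi hmax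
  have hs : (gameA p n *ᵥ d) i = gameA p n i i * d i := by
    rw [gameA_mulVec_apply]
    exact Finset.sum_eq_single i (fun j _ hj => by
      rcases lt_or_gt_of_ne hj with h | h
      · simp [gameA_of_gt h]
      · have : d j = 0 := by
          by_contra hdj
          exact absurd (hmax j hdj) (not_le.2 h)
        simp [this]) (by simp)
  rw [hd i hi, gameA_self] at hs
  have : 0 < p ^ (i + 1 : ℕ) * p ^ (i + 1 : ℕ) := by positivity
  rcases mul_eq_zero.1 hs.symm with h | h
  · exact this.ne' h
  · exact hi h

/-- Each index set `S` supports a nonnegative vector whose payoff is `1` on `S` and smaller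
elsewhere. -/
lemma exists_gameA_mulVec_eq_one (hp : 2 < p) (S : Finset (Fin n)) :
    ∃ w : Fin n → ℝ, (∀ i, 0 ≤ w i) ∧ (∀ i, w i ≠ 0 ↔ i ∈ S) ∧
      (∀ i ∈ S, (gameA p n *ᵥ w) i = 1) ∧ ∀ i ∉ S, (gameA p n *ᵥ w) i < 1 := by
  have hp0 : 0 < p := by linarith
  induction S using Finset.induction_on_min with
  | empty => exact ⟨0, by simp⟩
  | insert a S ha ih =>
    obtain ⟨w, hw0, hwS, hw1, hwlt⟩ := ih
    have haS : a ∉ S := fun h => lt_irrefl a (ha a h)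
    have hpa : 0 < p ^ (a + 1 : ℕ) := by positivity
    set r := (gameA p n *ᵥ w) a with hr
    have hr1 : r < 1 := hwlt a haS
    have hr0 : 0 ≤ r := gameA_mulVec_nonneg hp0.le hw0 a
    set c := (1 - r) / (p ^ (a + 1 : ℕ) * p ^ (a + 1 : ℕ)) with hc
    have hcpos : 0 < c := div_pos (by linarith) (by positivity)
    have hcmul : p ^ (a + 1 : ℕ) * p ^ (a + 1 : ℕ) * c = 1 - r := by
      rw [hc]; field_simp
    have hrow : ∀ i, (gameA p n *ᵥ (w + Pi.single a c)) i
        = (gameA p n *ᵥ w) i + gameA p n i a * c := fun i => by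
      simp [mulVec_add, mulVec_single, mul_comm]
    have hwa : w a = 0 := by
      by_contra h
      exact haS ((hwS a).1 h)
    have hrowa : (gameA p n *ᵥ (w + Pi.single a c)) a = 1 := by
      rw [hrow, gameA_self, hcmul, ← hr]; ring
    have hrowgt : ∀ i, a < i →
        (gameA p n *ᵥ (w + Pi.single a c)) i = (gameA p n *ᵥ w) i := fun i hi => by
      rw [hrow, gameA_of_gt hi]; ring
    refine ⟨w + Pi.single a c, fun i => ?_, fun i => ?_, fun i hi => ?_, fun i hi => ?_⟩
    · by_cases h : i = a
      · subst h; simp [hwa, hcpos.le]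
      · simp [h, hw0 i]
    · by_cases h : i = a
      · subst h; simp [hwa, hcpos.ne']
      · simpa [h] using hwS i
    · rcases Finset.mem_insert.1 hi with rfl | hi
      · exact hrowa
      · rw [hrowgt i (ha i hi), hw1 i hi]
    · rw [Finset.mem_insert, not_or] at hi
      rcases lt_or_gt_of_ne hi.1 with h | h
      · have hprop : p ^ (a + 1 : ℕ) * (gameA p n *ᵥ w) i = p ^ (i + 1 : ℕ) * r := by
          simp only [hr, mulVec, dotProduct, Finset.mul_sum]
          refine Finset.sum_congr rfl fun j _ => ?_
          by_cases hj : j ∈ S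
          · rw [gameA_of_lt (ha j hj), gameA_of_lt (h.trans (ha j hj))]; ring
          · have : w j = 0 := by
              by_contra h'
              exact hj ((hwS j).1 h')
            simp [this]
        have hpow : 2 * p ^ (i + 1 : ℕ) < p ^ (a + 1 : ℕ) :=
          two_mul_pow_lt_pow hp (Nat.succ_lt_succ h)
        have hpi : 0 < p ^ (i + 1 : ℕ) := by positivity
        refine lt_of_mul_lt_mul_left (a := p ^ (a + 1 : ℕ)) ?_ hpa.le
        have : p ^ (a + 1 : ℕ) * (gameA p n *ᵥ (w + Pi.single a c)) i
            = p ^ (i + 1 : ℕ) * (2 - r) := by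
          rw [hrow, mul_add, hprop, gameA_of_lt h]
          linear_combination 2 * p ^ (i + 1 : ℕ) * hcmul
        rw [this]
        nlinarith [mul_nonneg hpi.le hr0]
      · rw [hrowgt i h]
        exact hwlt i hi.2

end gameA

theorem stmt6 (p : ℝ) (hp : 2 < p) (n : ℕ) (hn : 0 < n) :
    {q : (Fin n → ℝ) × (Fin n → ℝ) |
        IsNash (gameA p n) (gameA p n)ᵀ q.1 q.2}.Finite ∧
    {q : (Fin n → ℝ) × (Fin n → ℝ) |
        IsNash (gameA p n) (gameA p n)ᵀ q.1 q.2}.ncard = 2 ^ n - 1 := by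
  have hp0 : 0 < p := by linarith
  choose w hw0 hwS hw1 hwlt using exists_gameA_mulVec_eq_one (n := n) hp
  set z : Finset (Fin n) → Fin n → ℝ := fun S => (∑ i, w S i)⁻¹ • w S with hz
  have hpos : ∀ S : Finset (Fin n), S.Nonempty → 0 < ∑ i, w S i := by
    rintro S ⟨i, hi⟩
    exact Finset.sum_pos' (fun j _ => hw0 S j)
      ⟨i, Finset.mem_univ i, lt_of_le_of_ne (hw0 S i) ((hwS S i).2 hi).symm⟩
  have hzS : ∀ S : Finset (Fin n), S.Nonempty → ∀ i, z S i ≠ 0 ↔ i ∈ S := fun S hS i => by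
    simp only [hz, Pi.smul_apply, smul_eq_mul, ← hwS S i, mul_ne_zero_iff]
    simp [(hpos S hS).ne']
  -- A mixed strategy that is constant-payoff on its support `S` is the canonical one.
  have huniq : ∀ (S : Finset (Fin n)) (y : Fin n → ℝ) (c : ℝ), IsMixed y →
      (∀ i, y i ≠ 0 ↔ i ∈ S) → (∀ i ∈ S, (gameA p n *ᵥ y) i = c) → y = z S := by
    intro S y c hy hyS hyc
    have h0 : y - c • w S = 0 := by
      refine eq_zero_of_gameA_mulVec_eq_zero hp0 fun i hi => ?_
      have hiS : i ∈ S := by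
        by_contra h
        have h1 : y i = 0 := by
          by_contra h'
          exact h ((hyS i).1 h')
        have h2 : w S i = 0 := by
          by_contra h'
          exact h ((hwS S i).1 h')
        simp [h1, h2] at hi
      simp [mulVec_sub, mulVec_smul, hyc i hiS, hw1 S i hiS]
    have h1 : y = c • w S := sub_eq_zero.1 h0
    have hsum : c * ∑ i, w S i = 1 := by
      rw [← hy.2, h1, Finset.mul_sum]; rfl
    rw [h1, hz, eq_inv_of_mul_eq_one_left hsum]
  have himage : {q : (Fin n → ℝ) × (Fin n → ℝ) |
      IsNash (gameA p n) (gameA p n)ᵀ q.1 q.2} =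
      (fun S => (z S, z S)) '' {S : Finset (Fin n) | S.Nonempty} := by
    ext ⟨x, y⟩
    simp only [Set.mem_ofPred_eq, Set.mem_image, Prod.mk.injEq, isNash_transpose_iff]
    constructor
    · rintro ⟨hx, hy, ⟨c, hc⟩, ⟨d, hd⟩⟩
      have hxy : ∀ i, x i ≠ 0 → y i ≠ 0 := fun i hi =>
        ne_zero_of_gameA_mulVec_eq_max hp hy (fun j => (hc j).1) ((hc i).2 hi)
      have hyx : ∀ i, y i ≠ 0 → x i ≠ 0 := fun i hi =>
        ne_zero_of_gameA_mulVec_eq_max hp hx (fun j => (hd j).1) ((hd i).2 hi)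
      obtain ⟨k, hk⟩ := hx.exists_pos
      refine ⟨Finset.univ.filter fun i => x i ≠ 0, ⟨k, by simpa using hk.ne'⟩, ?_, ?_⟩
      · refine (huniq _ x d hx (fun i => by simp) fun i hi => (hd i).2 (hxy i ?_)).symm
        simpa using hi
      · refine (huniq _ y c hy (fun i => ?_) fun i hi => (hc i).2 ?_).symm
        · simpa using not_congr (not_iff_not.1 ⟨hyx i, hxy i⟩)
        · simpa using hi
    · rintro ⟨S, hS, rfl, rfl⟩
      have hmix : IsMixed (z S) :=
        ⟨fun i => mul_nonneg (inv_nonneg.2 (hpos S hS).le) (hw0 S i), by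
          simp only [hz, Pi.smul_apply, smul_eq_mul, ← Finset.mul_sum]
          exact inv_mul_cancel₀ (hpos S hS).ne'⟩
      have hmul : ∀ i, (gameA p n *ᵥ z S) i = (∑ i, w S i)⁻¹ * (gameA p n *ᵥ w S) i :=
        fun i => by simp [hz, mulVec_smul]
      have hbest : ∃ c : ℝ, ∀ i, (gameA p n *ᵥ z S) i ≤ c ∧
          (z S i ≠ 0 → (gameA p n *ᵥ z S) i = c) := by
        refine ⟨(∑ i, w S i)⁻¹, fun i => ⟨?_, fun hi => ?_⟩⟩
        · rw [hmul]
          refine mul_le_of_le_one_right (inv_nonneg.2 (hpos S hS).le) ?_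
          by_cases hi : i ∈ S
          · exact (hw1 S i hi).le
          · exact (hwlt S i hi).le
        · rw [hmul, hw1 S i ((hzS S hS i).1 hi), mul_one]
      exact ⟨hmix, hmix, hbest, hbest⟩
  have hinj : Set.InjOn (fun S => (z S, z S)) {S : Finset (Fin n) | S.Nonempty} := by
    intro S hS T hT h
    have hST : z S = z T := congrArg Prod.fst h
    ext i
    rw [← hzS S hS, ← hzS T hT, hST]
  rw [himage]
  refine ⟨(Set.toFinite _).image _, ?_⟩
  have hcompl : {S : Finset (Fin n) | S.Nonempty} = {∅}ᶜ := by
    ext S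
    simp [Finset.nonempty_iff_ne_empty]
  rw [hinj.ncard_image, hcompl, Set.ncard_compl, Set.ncard_singleton]
  simp
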